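/- arXiv:2111.05440 — 3 statements merged into one kernel-verified Lean document; each statement's English description precedes it below -/
import Mathlib

section
/- Let V̂ : S → ℝ satisfy the PessORL fixed-point equation V̂(s) = (B^π V̂)(s) − Δ(s) for every state s, and let V : S → ℝ satisfy the Bellman equation V(s) = (B^π V)(s) for every state s. If for every state s one has ε · (|d^φ s − d^β s| / d^β s) · ∑_a (π s a)² / (π_β s a) ≤ α · D_CQL(s), then V̂(s) ≤ V(s) for every state s (the learned pessimistic value function lower-bounds the true value function). -/
/-- A weighted average of a function bounded above by `M` is at most `M`. -/
theorem weighted_sum_le_of_le {ι : Type*} [Fintype ι] {w f : ι → ℝ} {M : ℝ}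
    (hw0 : ∀ i, 0 ≤ w i) (hw1 : ∑ i, w i = 1) (hf : ∀ i, f i ≤ M) :
    ∑ i, w i * f i ≤ M :=
  calc ∑ i, w i * f i ≤ ∑ i, w i * M :=
        Finset.sum_le_sum fun i _ => mul_le_mul_of_nonneg_left (hf i) (hw0 i)
    _ = M := by rw [← Finset.sum_mul, hw1, one_mul]


/-- PessORL value lower bound (Theorem 1 of the paper, tabular form):
if `V̂` satisfies the PessORL fixed-point equation `V̂ = B^π V̂ - Δ`, `V` satisfies
the Bellman equation `V = B^π V`, and the trade-off condition
`ε * (|d^φ s - d^β s| / d^β s) * ∑ a, (π s a)^2 / π_β s a ≤ α * D_CQL s` holds at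
every state, then `V̂ ≤ V` pointwise. -/
theorem pessorl_value_lower_bound
    {S A : Type*} [Fintype S] [Nonempty S] [Fintype A] [Nonempty A]
    (T : S → A → S → ℝ) (r : S → A → ℝ) (γ : ℝ)
    (π πβ : S → A → ℝ) (dφ dβ : S → ℝ) (ε α : ℝ)
    (hT0 : ∀ s a s', 0 ≤ T s a s') (hT1 : ∀ s a, ∑ s', T s a s' = 1)
    (hγ0 : 0 ≤ γ) (hγ1 : γ < 1)
    (hπ0 : ∀ s a, 0 ≤ π s a) (hπ1 : ∀ s, ∑ a, π s a = 1)
    (hπβ0 : ∀ s a, 0 < πβ s a) (hπβ1 : ∀ s, ∑ a, πβ s a = 1)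
    (hdφ0 : ∀ s, 0 ≤ dφ s) (hdφ1 : ∑ s, dφ s = 1)
    (hdβ0 : ∀ s, 0 < dβ s) (hdβ1 : ∑ s, dβ s = 1)
    (hε : 0 < ε) (hα : 0 < α)
    (Bπ : (S → ℝ) → S → ℝ)
    (hB : ∀ V s, Bπ V s = ∑ a, π s a * (r s a + γ * ∑ s', T s a s' * V s'))
    (Δ : S → ℝ)
    (hΔ : ∀ s, Δ s = ε * ((dφ s - dβ s) / dβ s) * (∑ a, (π s a) ^ 2 / πβ s a)
        + α * ∑ a, π s a * (π s a / πβ s a - 1))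
    (DCQL : S → ℝ)
    (hD : ∀ s, DCQL s = ∑ a, π s a * (π s a / πβ s a - 1))
    (Vhat V : S → ℝ)
    (hVhat : ∀ s, Vhat s = Bπ Vhat s - Δ s)
    (hV : ∀ s, V s = Bπ V s)
    (hcond : ∀ s, ε * (|dφ s - dβ s| / dβ s) * (∑ a, (π s a) ^ 2 / πβ s a)
        ≤ α * DCQL s) :
    ∀ s, Vhat s ≤ V s := by
  have hΔ0 : ∀ s, 0 ≤ Δ s := by
    intro s
    have hC : 0 ≤ ∑ a, (π s a) ^ 2 / πβ s a :=
      Finset.sum_nonneg fun a _ => div_nonneg (sq_nonneg _) (hπβ0 s a).le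
    have hratio : -((dφ s - dβ s) / dβ s) ≤ |dφ s - dβ s| / dβ s := by
      rw [← neg_div]
      exact div_le_div_of_nonneg_right (neg_le_abs _) (hdβ0 s).le
    have hpenalty := mul_le_mul_of_nonneg_right (mul_le_mul_of_nonneg_left hratio hε.le) hC
    have hs := hcond s
    rw [hD] at hs
    rw [hΔ]
    linarith
  obtain ⟨s₀, hs₀⟩ := Finite.exists_max fun s => Vhat s - V s
  have hdiff : Bπ Vhat s₀ - Bπ V s₀
      = ∑ a, π s₀ a * (γ * ∑ s', T s₀ a s' * (Vhat s' - V s')) := by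
    rw [hB, hB, ← Finset.sum_sub_distrib]
    refine Finset.sum_congr rfl fun a _ => ?_
    simp only [mul_sub, Finset.sum_sub_distrib]
    ring
  have hcontr : Bπ Vhat s₀ - Bπ V s₀ ≤ γ * (Vhat s₀ - V s₀) := by
    rw [hdiff]
    exact weighted_sum_le_of_le (hπ0 s₀) (hπ1 s₀) fun a =>
      mul_le_mul_of_nonneg_left (weighted_sum_le_of_le (hT0 s₀ a) (hT1 s₀ a) hs₀) hγ0
  have hmax : Vhat s₀ - V s₀ ≤ 0 := by
    nlinarith [hVhat s₀, hV s₀, hΔ0 s₀]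
  intro s
  linarith [hs₀ s]
end

section
/- Value lower bound in the presence of bounded Bellman-operator (sampling) error: let e ≥ 0, let η : S → ℝ satisfy |η(s)| ≤ e for every state s, let V̂ : S → ℝ satisfy the perturbed PessORL fixed-point equation V̂(s) = (B^π V̂)(s) − Δ(s) + η(s) for every state s, and let V : S → ℝ satisfy V(s) = (B^π V)(s) for every state s. If for every state s one has ε · (|d^φ s − d^β s| / d^β s) · ∑_a (π s a)² / (π_β s a) + e ≤ α · D_CQL(s), then V̂(s) ≤ V(s) for every state s. -/
/-- If `V ≤ W + M` pointwise, then applying the Bellman operator shrinks the gap by `γ`. -/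
theorem bellman_le_add_of_le_add {S A : Type*} [Fintype S] [Fintype A]
    {T : S → A → S → ℝ} {r π : S → A → ℝ} {γ M : ℝ} {V W : S → ℝ} (s : S)
    (hT0 : ∀ a s', 0 ≤ T s a s') (hT1 : ∀ a, ∑ s', T s a s' = 1) (hγ0 : 0 ≤ γ)
    (hπ0 : ∀ a, 0 ≤ π s a) (hπ1 : ∑ a, π s a = 1) (h : ∀ s', V s' ≤ W s' + M) :
    ∑ a, π s a * (r s a + γ * ∑ s', T s a s' * V s') ≤
      ∑ a, π s a * (r s a + γ * ∑ s', T s a s' * W s') + γ * M := by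
  have step (a : A) : ∑ s', T s a s' * V s' ≤ ∑ s', T s a s' * W s' + M :=
    calc ∑ s', T s a s' * V s' ≤ ∑ s', T s a s' * (W s' + M) :=
          Finset.sum_le_sum fun s' _ => mul_le_mul_of_nonneg_left (h s') (hT0 a s')
      _ = ∑ s', T s a s' * W s' + M := by
          simp_rw [mul_add, Finset.sum_add_distrib, ← Finset.sum_mul, hT1, one_mul]
  calc ∑ a, π s a * (r s a + γ * ∑ s', T s a s' * V s')
      ≤ ∑ a, π s a * ((r s a + γ * ∑ s', T s a s' * W s') + γ * M) := by
        refine Finset.sum_le_sum fun a _ => mul_le_mul_of_nonneg_left ?_ (hπ0 a)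
        linarith [mul_le_mul_of_nonneg_left (step a) hγ0]
    _ = ∑ a, π s a * (r s a + γ * ∑ s', T s a s' * W s') + γ * M := by
        simp_rw [mul_add _ _ (γ * M), Finset.sum_add_distrib, ← Finset.sum_mul, hπ1, one_mul]

/-- PessORL value lower bound in the presence of bounded Bellman-operator
(sampling) error: if `V̂` satisfies the perturbed PessORL fixed-point equation
`V̂ = B^π V̂ - Δ + η` with `|η| ≤ e`, `V` satisfies the Bellman equation
`V = B^π V`, and at every state
`ε * (|d^φ s - d^β s| / d^β s) * ∑ a, (π s a)^2 / π_β s a + e ≤ α * D_CQL s`,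
then `V̂ ≤ V` pointwise. -/
theorem pessorl_value_lower_bound_sampling_error
    {S A : Type*} [Fintype S] [Nonempty S] [Fintype A] [Nonempty A]
    (T : S → A → S → ℝ) (r : S → A → ℝ) (γ : ℝ)
    (π πβ : S → A → ℝ) (dφ dβ : S → ℝ) (ε α : ℝ)
    (hT0 : ∀ s a s', 0 ≤ T s a s') (hT1 : ∀ s a, ∑ s', T s a s' = 1)
    (hγ0 : 0 ≤ γ) (hγ1 : γ < 1)
    (hπ0 : ∀ s a, 0 ≤ π s a) (hπ1 : ∀ s, ∑ a, π s a = 1)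
    (hπβ0 : ∀ s a, 0 < πβ s a) (hπβ1 : ∀ s, ∑ a, πβ s a = 1)
    (hdφ0 : ∀ s, 0 ≤ dφ s) (hdφ1 : ∑ s, dφ s = 1)
    (hdβ0 : ∀ s, 0 < dβ s) (hdβ1 : ∑ s, dβ s = 1)
    (hε : 0 < ε) (hα : 0 < α)
    (Bπ : (S → ℝ) → S → ℝ)
    (hB : ∀ V s, Bπ V s = ∑ a, π s a * (r s a + γ * ∑ s', T s a s' * V s'))
    (Δ : S → ℝ)
    (hΔ : ∀ s, Δ s = ε * ((dφ s - dβ s) / dβ s) * (∑ a, (π s a) ^ 2 / πβ s a)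
        + α * ∑ a, π s a * (π s a / πβ s a - 1))
    (DCQL : S → ℝ)
    (hD : ∀ s, DCQL s = ∑ a, π s a * (π s a / πβ s a - 1))
    (e : ℝ) (he : 0 ≤ e)
    (η : S → ℝ) (hη : ∀ s, |η s| ≤ e)
    (Vhat V : S → ℝ)
    (hVhat : ∀ s, Vhat s = Bπ Vhat s - Δ s + η s)
    (hV : ∀ s, V s = Bπ V s)
    (hcond : ∀ s, ε * (|dφ s - dβ s| / dβ s) * (∑ a, (π s a) ^ 2 / πβ s a) + e
        ≤ α * DCQL s) :
    ∀ s, Vhat s ≤ V s := by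
  have hpen (s : S) : η s ≤ Δ s := by
    have hX : 0 ≤ ∑ a, (π s a) ^ 2 / πβ s a :=
      Finset.sum_nonneg fun a _ => div_nonneg (sq_nonneg _) (hπβ0 s a).le
    have hratio : -(|dφ s - dβ s| / dβ s) ≤ (dφ s - dβ s) / dβ s := by
      rw [← neg_div]
      exact div_le_div_of_nonneg_right (neg_abs_le _) (hdβ0 s).le
    have hmul := mul_le_mul_of_nonneg_right (mul_le_mul_of_nonneg_left hratio hε.le) hX
    have hη' := (le_abs_self _).trans (hη s)
    have hc := hcond s
    rw [hD] at hc
    rw [hΔ]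
    linarith
  obtain ⟨s₀, hs₀⟩ := Finite.exists_max fun s => Vhat s - V s
  have hcontract := bellman_le_add_of_le_add (r := r) s₀ (hT0 s₀) (hT1 s₀) hγ0 (hπ0 s₀) (hπ1 s₀)
    fun s' => sub_le_iff_le_add'.mp (hs₀ s')
  rw [← hB, ← hB] at hcontract
  have hmax : Vhat s₀ - V s₀ ≤ 0 := by
    nlinarith [hVhat s₀, hV s₀, hpen s₀]
  intro s
  linarith [hs₀ s]
end

section
/- Monotonicity of the inverse discounted transition operator: let P be a row-stochastic matrix over a nonempty finite type S (all entries nonnegative, every row sums to 1), let γ ∈ [0, 1), and let v, d : S → ℝ satisfy (1 − γ • P).mulVec v = d, i.e. v(s) − γ · ∑_{s'} P s s' · v(s') = d(s) for all s. If d(s) ≥ 0 for every s, then v(s) ≥ 0 for every s. (Equivalently, (I − γP)⁻¹ maps entrywise-nonnegative vectors to entrywise-nonnegative vectors.) -/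
/-- Monotonicity of the inverse discounted transition operator: for a
row-stochastic matrix `P` over a nonempty finite type and `0 ≤ γ < 1`, if
`(1 - γ • P).mulVec v = d` and `d` is entrywise nonnegative, then `v` is
entrywise nonnegative. -/
theorem discounted_transition_inverse_monotone
    {S : Type*} [Fintype S] [Nonempty S] [DecidableEq S]
    (P : Matrix S S ℝ)
    (hP0 : ∀ s s', 0 ≤ P s s') (hP1 : ∀ s, ∑ s', P s s' = 1)
    (γ : ℝ) (hγ0 : 0 ≤ γ) (hγ1 : γ < 1)
    (v d : S → ℝ)
    (hvd : (1 - γ • P).mulVec v = d)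
    (hd : ∀ s, 0 ≤ d s) :
    ∀ s, 0 ≤ v s := by
  obtain ⟨m, hm⟩ := Finite.exists_min v
  have hmean : v m ≤ ∑ s', P m s' * v s' :=
    calc v m = ∑ s', P m s' * v m := by rw [← Finset.sum_mul, hP1, one_mul]
      _ ≤ ∑ s', P m s' * v s' :=
        Finset.sum_le_sum fun s' _ => mul_le_mul_of_nonneg_left (hm s') (hP0 m s')
  have hdm : v m - γ * ∑ s', P m s' * v s' = d m := by
    rw [← hvd, Matrix.sub_mulVec, Matrix.one_mulVec, Matrix.smul_mulVec]
    rfl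
  have hvm : 0 ≤ (1 - γ) * v m := by
    linarith [hd m, mul_le_mul_of_nonneg_left hmean hγ0]
  exact fun s => (nonneg_of_mul_nonneg_right hvm (sub_pos.2 hγ1)).trans (hm s)
end
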